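/- Let a < 0, b > 0 with b/(−a) < (427 + 3√41781)/130, set c = a, w = 0, ε ∈ {−1, 1}, φ(x) := −(3/2)·sech²(x/(2√(−a))), ψ(x) := ε·(3/√2)·sech²(x/(2√(−a))). Then there do not exist λ ∈ ℂ with Re λ > 0 and functions v, z : ℝ → ℂ, not both identically zero, each infinitely differentiable with every derivative (including order zero) square-integrable on ℝ, such that for all x ∈ ℝ: −d/dx[ ψ(x)·v(x) + z(x) + a·z''(x) + φ(x)·z(x) ] = λ·(v(x) − b·v''(x)) and −d/dx[ v(x) + a·v''(x) + ψ(x)·z(x) ] = λ·(z(x) − b·z''(x)). -/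

import Mathlib

open MeasureTheory

section Auxiliary

open Set Filter Topology

noncomputable def sech2 (x : ℝ) : ℝ := 1 / Real.cosh x ^ 2

lemma sech2_pos (x : ℝ) : 0 < sech2 x := by
  have := Real.cosh_pos x
  unfold sech2; positivity

lemma sech2_eq (x : ℝ) : sech2 x = 1 - Real.tanh x ^ 2 := by
  have := Real.cosh_pos x
  rw [sech2, Real.tanh_eq_sinh_div_cosh]
  field_simp
  rw [Real.cosh_sq]; ring

lemma sech2_le_one (x : ℝ) : sech2 x ≤ 1 := by
  rw [sech2_eq]; nlinarith [sq_nonneg (Real.tanh x)]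

lemma abs_tanh_le_one (x : ℝ) : |Real.tanh x| ≤ 1 := by
  have h := sech2_pos x
  rw [sech2_eq] at h
  exact (sq_le_one_iff_abs_le_one _).1 (by linarith)

lemma hasDerivAt_tanh (x : ℝ) : HasDerivAt Real.tanh (sech2 x) x := by
  have hc := (Real.cosh_pos x).ne'
  have h := (Real.hasDerivAt_sinh x).div (Real.hasDerivAt_cosh x) hc
  have e : Real.tanh = Real.sinh / Real.cosh := by
    ext y; simp [Real.tanh_eq_sinh_div_cosh]
  rw [e]
  have e2 : sech2 x = (Real.cosh x * Real.cosh x - Real.sinh x * Real.sinh x) /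
      Real.cosh x ^ 2 := by
    rw [sech2, ← Real.cosh_sq_sub_sinh_sq x]; ring
  rw [e2]; exact h

lemma hasDerivAt_sech2 (x : ℝ) :
    HasDerivAt sech2 (-2 * Real.tanh x * sech2 x) x := by
  have h := ((hasDerivAt_tanh x).pow 2).const_sub 1
  have e : sech2 = fun y => 1 - (Real.tanh ^ 2) y := by
    ext y; simp [sech2_eq]
  have e2 : -2 * Real.tanh x * sech2 x =
      -(((2 : ℕ) : ℝ) * Real.tanh x ^ (2 - 1) * sech2 x) := by
    norm_num
  rw [e2]
  exact e ▸ h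

lemma continuous_tanh' : Continuous Real.tanh :=
  continuous_iff_continuousAt.2 fun x => (hasDerivAt_tanh x).continuousAt

lemma continuous_sech2 : Continuous sech2 :=
  continuous_iff_continuousAt.2 fun x => (hasDerivAt_sech2 x).continuousAt

lemma sq_mul_sech2_le_one (x : ℝ) : (1 + x ^ 2) * sech2 x ≤ 1 := by
  have hc := Real.cosh_pos x
  have h : x ^ 2 ≤ Real.sinh x ^ 2 := by
    rw [sq_le_sq, Real.abs_sinh]
    exact Real.self_le_sinh_iff.2 (abs_nonneg x)
  rw [sech2, mul_one_div, div_le_one (by positivity), Real.cosh_sq]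
  linarith

lemma integrable_sech2 : Integrable sech2 := by
  refine integrable_inv_one_add_sq.mono' continuous_sech2.aestronglyMeasurable
    (.of_forall fun x => ?_)
  rw [Real.norm_of_nonneg (sech2_pos x).le, ← one_div, le_div_iff₀ (by positivity), mul_comm]
  exact sq_mul_sech2_le_one x

lemma memLp_sech2 : MemLp sech2 2 := by
  rw [memLp_two_iff_integrable_sq continuous_sech2.aestronglyMeasurable]
  refine integrable_sech2.mono' (continuous_sech2.pow 2).aestronglyMeasurable
    (.of_forall fun x => ?_)
  rw [Real.norm_of_nonneg (by positivity)]
  nlinarith [sech2_pos x, sech2_le_one x]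

lemma memLp_id_mul_sech2 : MemLp (fun x => x * sech2 x) 2 := by
  have hc : Continuous fun x => x * sech2 x := continuous_id.mul continuous_sech2
  rw [memLp_two_iff_integrable_sq hc.aestronglyMeasurable]
  refine integrable_sech2.mono' (hc.pow 2).aestronglyMeasurable (.of_forall fun x => ?_)
  rw [Real.norm_of_nonneg (by positivity)]
  nlinarith [sech2_pos x, sech2_le_one x, sq_mul_sech2_le_one x]

/-- Square-integrability is preserved by multiplication with `tanh`. -/
lemma MemLp.mul_tanh {f : ℝ → ℝ} (hf : MemLp f 2) :
    MemLp (fun x => f x * Real.tanh x) 2 := by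
  refine hf.of_le (hf.1.mul continuous_tanh'.aestronglyMeasurable) (.of_forall fun x => ?_)
  rw [norm_mul]
  exact mul_le_of_le_one_right (norm_nonneg _) (abs_tanh_le_one x)

/-- Square-integrability is preserved by multiplication with `sech²`. -/
lemma MemLp.mul_sech2 {f : ℝ → ℝ} (hf : MemLp f 2) :
    MemLp (fun x => f x * sech2 x) 2 := by
  refine hf.of_le (hf.1.mul continuous_sech2.aestronglyMeasurable) (.of_forall fun x => ?_)
  rw [norm_mul]
  refine mul_le_of_le_one_right (norm_nonneg _) ?_
  rw [Real.norm_of_nonneg (sech2_pos x).le]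
  exact sech2_le_one x

lemma tendsto_div_tanh {y : ℝ → ℝ} {d : ℝ} (hy : HasDerivAt y d 0) (h0 : y 0 = 0) :
    Tendsto (fun x => y x ^ 2 / Real.tanh x) (𝓝[≠] 0) (𝓝 0) := by
  have h1 := hasDerivAt_iff_tendsto_slope_zero.1 hy
  have h2 := hasDerivAt_iff_tendsto_slope_zero.1 (hasDerivAt_tanh 0)
  have h3 : Tendsto y (𝓝[≠] 0) (𝓝 0) := by
    simpa [h0] using hy.continuousAt.tendsto.mono_left nhdsWithin_le_nhds
  have h4 := (h3.mul h1).div h2 (sech2_pos 0).ne'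
  simp only [zero_mul, zero_div] at h4
  refine h4.congr' ?_
  filter_upwards [self_mem_nhdsWithin] with x hx
  have hx : x ≠ 0 := hx
  simp only [zero_add, h0, Real.tanh_zero, sub_zero, smul_eq_mul, Pi.div_apply]
  by_cases ht : Real.tanh x = 0
  · simp [ht]
  · field_simp

lemma half_line_form_nonneg {y y' : ℝ → ℝ} (hy : ∀ x, HasDerivAt y (y' x) x)
    (hc : Continuous y') (h0 : y 0 = 0) (hL : MemLp y 2) (hL' : MemLp y' 2) :
    0 ≤ ∫ x in Ioi 0, (y' x ^ 2 + (4 - 12 * sech2 x) * y x ^ 2) := by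
  have hyc : Continuous y := continuous_iff_continuousAt.2 fun x => (hy x).continuousAt
  set e : ℝ → ℝ := fun x => y' x ^ 2 + (4 - 12 * sech2 x) * y x ^ 2 with he
  have hec : Continuous e := by
    have := continuous_sech2
    fun_prop
  have hei : Integrable e := by
    have h := ((hL'.integrable_mul hL').add ((hL.integrable_mul hL).const_mul 4)).sub
      ((hL.integrable_mul (MemLp.mul_sech2 hL)).const_mul 12)
    refine h.congr (.of_forall fun x => ?_)
    simp [he]; ring
  have htp : ∀ x, 0 < x → 0 < Real.tanh x := fun x hx => by
    rw [Real.tanh_eq_sinh_div_cosh]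
    exact div_pos (Real.sinh_pos_iff.2 hx) (Real.cosh_pos x)
  set F : ℝ → ℝ := fun x => y x ^ 2 / Real.tanh x - 3 * (y x ^ 2 * Real.tanh x) with hF
  set G : ℝ → ℝ := fun x => (∫ t in (0 : ℝ)..x, e t) - F x with hG
  have hy2 : Tendsto (fun x => y x ^ 2) atTop (𝓝 0) := by
    refine tendsto_zero_of_hasDerivAt_of_integrableOn_Ioi (a := 0)
      (f' := fun x => 2 * (y x * y' x)) (fun x _ => ?_) ?_ ?_
    · refine ((hy x).fun_pow 2).congr_deriv ?_
      norm_num; ring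
    · exact ((hL.integrable_mul hL').const_mul 2).integrableOn
    · exact hL.integrable_sq.integrableOn
  have hT1 : 0 < Real.tanh 1 := htp 1 one_pos
  have hmono : MonotoneOn Real.tanh (Ici 0) := by
    refine (monotone_of_deriv_nonneg (fun x => (hasDerivAt_tanh x).differentiableAt)
      fun x => ?_).monotoneOn _
    rw [(hasDerivAt_tanh x).deriv]; exact (sech2_pos x).le
  have hFt : Tendsto F atTop (𝓝 0) := by
    have h1 : Tendsto (fun x => (1 / Real.tanh 1 + 3) * y x ^ 2) atTop (𝓝 0) := by
      simpa using hy2.const_mul (1 / Real.tanh 1 + 3)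
    refine squeeze_zero_norm' ?_ h1
    filter_upwards [eventually_ge_atTop 1] with x hx
    have h2 : Real.tanh 1 ≤ Real.tanh x :=
      hmono (by simp) (by simp; linarith) hx
    have h3 : y x ^ 2 / Real.tanh x ≤ y x ^ 2 / Real.tanh 1 := by gcongr
    have h4 : 0 ≤ y x ^ 2 / Real.tanh x := div_nonneg (sq_nonneg _) (by linarith)
    have h5 := abs_le.1 (abs_tanh_le_one x)
    have h6 : (1 / Real.tanh 1 + 3) * y x ^ 2 = y x ^ 2 / Real.tanh 1 + 3 * y x ^ 2 := by ring
    rw [h6, Real.norm_eq_abs, abs_le]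
    constructor <;> simp only [hF] <;> nlinarith [sq_nonneg (y x)]
  have hGt : Tendsto G atTop (𝓝 (∫ x in Ioi 0, e x)) := by
    simpa using (intervalIntegral_tendsto_integral_Ioi 0 hei.integrableOn tendsto_id).sub hFt
  have hG0 : G 0 = 0 := by simp [hG, hF]
  have hGd : ∀ x, 0 < x →
      HasDerivAt G ((y' x - (1 / Real.tanh x - 3 * Real.tanh x) * y x) ^ 2) x := fun x hx => by
    have ht := (htp x hx).ne'
    have h1 := intervalIntegral.integral_hasDerivAt_right (hec.intervalIntegrable 0 x)
      (hec.stronglyMeasurableAtFilter _ _) hec.continuousAt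
    have hy2 := (hy x).fun_pow 2
    have h2 := (hy2.fun_div (hasDerivAt_tanh x) ht).fun_sub
      ((hy2.fun_mul (hasDerivAt_tanh x)).const_mul 3)
    refine (h1.fun_sub h2).congr_deriv ?_
    simp only [he, sech2_eq]
    field_simp
    push_cast
    ring
  have hGc : ContinuousOn G (Ici 0) := by
    intro x hx
    rcases (show (0:ℝ) ≤ x from hx).eq_or_lt with rfl | hx
    · rw [← continuousWithinAt_Ioi_iff_Ici]
      have h1 : Tendsto F (𝓝[>] 0) (𝓝 0) := by
        have a1 := (tendsto_div_tanh (hy 0) h0).mono_left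
          (nhdsWithin_mono 0 (fun x (hx : x ∈ Ioi 0) => (show (0 : ℝ) < x from hx).ne'))
        have a2 : Tendsto (fun x => 3 * (y x ^ 2 * Real.tanh x)) (𝓝[>] 0) (𝓝 0) := by
          have : Continuous fun x => 3 * (y x ^ 2 * Real.tanh x) := by
            have := continuous_tanh'
            fun_prop
          simpa [h0] using (this.tendsto 0).mono_left nhdsWithin_le_nhds
        simpa using a1.sub a2
      have h2 : Tendsto (fun x => ∫ t in (0 : ℝ)..x, e t) (𝓝[>] 0) (𝓝 0) := by
        have := (intervalIntegral.continuous_primitive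
          (μ := volume) (fun a b => hec.intervalIntegrable a b) 0).tendsto 0
        simpa using this.mono_left nhdsWithin_le_nhds
      have := h2.sub h1
      rw [ContinuousWithinAt, hG0]
      simpa using this
    · exact (hGd x hx).continuousAt.continuousWithinAt
  have hGm : MonotoneOn G (Ici 0) := by
    refine monotoneOn_of_deriv_nonneg (convex_Ici 0) hGc ?_ ?_
    · rw [interior_Ici]
      exact fun x hx => (hGd x hx).differentiableAt.differentiableWithinAt
    · rw [interior_Ici]
      intro x hx
      rw [(hGd x hx).deriv]
      positivity
  refine ge_of_tendsto hGt ?_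
  filter_upwards [eventually_ge_atTop 0] with x hx
  rw [← hG0]
  exact hGm (by simp) hx hx

lemma sech2_neg (x : ℝ) : sech2 (-x) = sech2 x := by simp [sech2]

lemma MemLp.comp_neg_real {f : ℝ → ℝ} (hf : MemLp f 2) : MemLp (fun x => f (-x)) 2 :=
  hf.comp_measurePreserving (Measure.measurePreserving_neg volume)

/-- The form of `-∂² + 4 - 12 sech²` is nonnegative on functions vanishing at the origin. -/
lemma form_nonneg_of_zero {y y' : ℝ → ℝ} (hy : ∀ x, HasDerivAt y (y' x) x)
    (hc : Continuous y') (h0 : y 0 = 0) (hL : MemLp y 2) (hL' : MemLp y' 2) :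
    0 ≤ ∫ x, (y' x ^ 2 + (4 - 12 * sech2 x) * y x ^ 2) := by
  have hei : Integrable fun x => (y' x ^ 2 + (4 - 12 * sech2 x) * y x ^ 2) := by
    have h := ((hL'.integrable_mul hL').add ((hL.integrable_mul hL).const_mul 4)).sub
      ((hL.integrable_mul (MemLp.mul_sech2 hL)).const_mul 12)
    refine h.congr (.of_forall fun x => ?_)
    simp; ring
  have h1 := half_line_form_nonneg hy hc h0 hL hL'
  have h2 := half_line_form_nonneg (y := fun x => y (-x)) (y' := fun x => -y' (-x))
    (fun x => by
      have := (hy (-x)).comp x (hasDerivAt_neg x)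
      simpa [Function.comp_def] using this) (by fun_prop) (by simpa using h0)
    (MemLp.comp_neg_real hL) (MemLp.comp_neg_real hL').neg
  have h3 := integral_comp_neg_Ioi 0 fun x => (y' x ^ 2 + (4 - 12 * sech2 x) * y x ^ 2)
  simp only [sech2_neg, neg_zero] at h3
  simp only [neg_sq, h3] at h2
  rw [← intervalIntegral.integral_Iic_add_Ioi (b := 0) hei.integrableOn hei.integrableOn]
  exact add_nonneg h2 h1

lemma MemLp.integrable_fun_mul {f g : ℝ → ℝ} (hf : MemLp f 2) (hg : MemLp g 2) :
    Integrable fun x => f x * g x :=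
  hf.integrable_mul hg

lemma integral_combination₃ {f₁ f₂ f₃ F : ℝ → ℝ} (h₁ : Integrable f₁) (h₂ : Integrable f₂)
    (h₃ : Integrable f₃) (c₁ c₂ c₃ : ℝ) (hF : ∀ x, F x = c₁ * f₁ x + c₂ * f₂ x + c₃ * f₃ x) :
    ∫ x, F x = c₁ * (∫ x, f₁ x) + c₂ * (∫ x, f₂ x) + c₃ * ∫ x, f₃ x := by
  have h₁₂ : Integrable fun x => c₁ * f₁ x + c₂ * f₂ x := (h₁.const_mul c₁).add (h₂.const_mul c₂)
  simp_rw [hF]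
  rw [integral_add h₁₂ (h₃.const_mul c₃), integral_add (h₁.const_mul c₁) (h₂.const_mul c₂)]
  simp only [integral_const_mul]

lemma integral_combination₄ {f₁ f₂ f₃ f₄ F : ℝ → ℝ} (h₁ : Integrable f₁) (h₂ : Integrable f₂)
    (h₃ : Integrable f₃) (h₄ : Integrable f₄) (c₁ c₂ c₃ c₄ : ℝ)
    (hF : ∀ x, F x = c₁ * f₁ x + c₂ * f₂ x + c₃ * f₃ x + c₄ * f₄ x) :
    ∫ x, F x = c₁ * (∫ x, f₁ x) + c₂ * (∫ x, f₂ x) + c₃ * (∫ x, f₃ x) + c₄ * ∫ x, f₄ x := by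
  have h : Integrable fun x => c₁ * f₁ x + c₂ * f₂ x + c₃ * f₃ x :=
    ((h₁.const_mul c₁).add (h₂.const_mul c₂)).add (h₃.const_mul c₃)
  rw [integral_combination₃ (F := F) (f₁ := fun x => c₁ * f₁ x + c₂ * f₂ x + c₃ * f₃ x)
    h h₄ h₄ 1 c₄ 0 (fun x => by rw [hF x]; ring),
    integral_combination₃ h₁ h₂ h₃ c₁ c₂ c₃ fun _ => rfl]
  ring

lemma integrable_sech2_pow (n : ℕ) : Integrable fun x => sech2 x ^ (n + 1) := by
  refine integrable_sech2.mono' (continuous_sech2.pow _).aestronglyMeasurable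
    (.of_forall fun x => ?_)
  have h := sech2_pos x
  rw [Real.norm_of_nonneg (by positivity), pow_succ]
  exact mul_le_of_le_one_left h.le (pow_le_one₀ h.le (sech2_le_one x))

lemma integrable_id_mul_tanh_mul_sech2_pow (n : ℕ) :
    Integrable fun x => x * Real.tanh x * sech2 x ^ (n + 2) := by
  have h := (memLp_id_mul_sech2.integrable_mul memLp_sech2).mul_bdd (c := 1)
    (continuous_tanh'.mul (continuous_sech2.pow n)).aestronglyMeasurable
    (.of_forall fun x => by
      rw [Pi.mul_apply, Pi.pow_apply, norm_mul, norm_pow, Real.norm_eq_abs, Real.norm_of_nonneg (sech2_pos x).le]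
      exact mul_le_one₀ (abs_tanh_le_one x) (by have := sech2_pos x; positivity)
        (pow_le_one₀ (sech2_pos x).le (sech2_le_one x)))
  refine h.congr (.of_forall fun x => ?_)
  simp; ring

/-- Reduction formula for the moments of `sech²`. -/
lemma integral_sech2_pow_succ (n : ℕ) :
    (2 * n + 3) * ∫ x, sech2 x ^ (n + 2) = (2 * n + 2) * ∫ x, sech2 x ^ (n + 1) := by
  have hd : ∀ x, HasDerivAt (fun x => Real.tanh x * sech2 x ^ (n + 1))
      ((2 * n + 3) * sech2 x ^ (n + 2) - (2 * n + 2) * sech2 x ^ (n + 1)) x := fun x => by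
    refine ((hasDerivAt_tanh x).fun_mul ((hasDerivAt_sech2 x).fun_pow (n + 1))).congr_deriv ?_
    have e : Real.tanh x ^ 2 = 1 - sech2 x := by rw [sech2_eq]; ring
    have e2 : Real.tanh x * (((n + 1 : ℕ) : ℝ) * sech2 x ^ (n + 1 - 1) *
        (-2 * Real.tanh x * sech2 x)) =
        -2 * (n + 1) * Real.tanh x ^ 2 * sech2 x ^ (n + 1) := by
      rw [Nat.add_sub_cancel, pow_succ]
      push_cast
      ring
    rw [e2, e]; ring
  have h1 := (integrable_sech2_pow (n + 1)).const_mul (2 * n + 3 : ℝ)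
  have h2 := (integrable_sech2_pow n).const_mul (2 * n + 2 : ℝ)
  have h3 : Integrable fun x => Real.tanh x * sech2 x ^ (n + 1) := by
    refine (integrable_sech2_pow n).mono
      (continuous_tanh'.mul (continuous_sech2.pow _)).aestronglyMeasurable (.of_forall fun x => ?_)
    rw [norm_mul]
    exact mul_le_of_le_one_left (norm_nonneg _) (abs_tanh_le_one x)
  have h := integral_eq_zero_of_hasDerivAt_of_integrable hd (h1.sub h2) h3
  rw [integral_sub h1 h2, integral_const_mul, integral_const_mul] at h
  linarith

lemma integral_id_mul_tanh_mul_sech2_pow (n : ℕ) :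
    (2 * n + 4) * ∫ x, x * Real.tanh x * sech2 x ^ (n + 2) = ∫ x, sech2 x ^ (n + 2) := by
  have hd : ∀ x, HasDerivAt (fun x => x * sech2 x ^ (n + 2))
      (sech2 x ^ (n + 2) - (2 * n + 4) * (x * Real.tanh x * sech2 x ^ (n + 2))) x := fun x => by
    refine ((hasDerivAt_id x).fun_mul ((hasDerivAt_sech2 x).fun_pow (n + 2))).congr_deriv ?_
    have e : n + 2 - 1 = n + 1 := rfl
    rw [e]
    push_cast
    simp only [id]
    ring
  have h1 := integrable_sech2_pow (n + 1)
  have h2 := (integrable_id_mul_tanh_mul_sech2_pow n).const_mul (2 * n + 4 : ℝ)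
  have h3 : Integrable fun x => x * sech2 x ^ (n + 2) := by
    have h := (memLp_id_mul_sech2.integrable_mul memLp_sech2).mul_bdd (c := 1)
      (continuous_sech2.pow n).aestronglyMeasurable
      (.of_forall fun x => by
        rw [Pi.pow_apply, norm_pow, Real.norm_of_nonneg (sech2_pos x).le]
        exact pow_le_one₀ (sech2_pos x).le (sech2_le_one x))
    refine h.congr (.of_forall fun x => ?_)
    simp; ring
  have h := integral_eq_zero_of_hasDerivAt_of_integrable hd (h1.sub h2) h3
  rw [integral_sub h1 h2, integral_const_mul] at h
  linarith

/-- The function `(1 - β ∂²) sech²`. -/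
noncomputable def dispersedSech2 (β x : ℝ) : ℝ := (1 - 4 * β) * sech2 x + 6 * β * sech2 x ^ 2

/-- The solution `ξ` of `(-∂² + 4 - 12 sech²) ξ = -(1 - β ∂²) sech²`. -/
noncomputable def resolventSech2 (β x : ℝ) : ℝ :=
  sech2 x / 4 - (1 - 4 * β) / 4 * (x * sech2 x * Real.tanh x)

noncomputable def resolventSech2' (β x : ℝ) : ℝ :=
  -(1 / 2 + (1 - 4 * β) / 4) * (sech2 x * Real.tanh x)
    - (1 - 4 * β) / 4 * (3 * (x * sech2 x * sech2 x) - 2 * (x * sech2 x))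

lemma hasDerivAt_resolventSech2 (β x : ℝ) :
    HasDerivAt (resolventSech2 β) (resolventSech2' β x) x := by
  have hS := hasDerivAt_sech2 x
  have hT := hasDerivAt_tanh x
  refine ((hS.div_const 4).fun_sub
    ((((hasDerivAt_id x).fun_mul hS).fun_mul hT).const_mul ((1 - 4 * β) / 4))).congr_deriv ?_
  simp only [resolventSech2', sech2_eq, id]
  ring

lemma hasDerivAt_resolventSech2' (β x : ℝ) :
    HasDerivAt (resolventSech2' β)
      ((4 - 12 * sech2 x) * resolventSech2 β x + dispersedSech2 β x) x := by
  have hS := hasDerivAt_sech2 x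
  have hT := hasDerivAt_tanh x
  have hX := (hasDerivAt_id x).fun_mul hS
  refine (((hS.fun_mul hT).const_mul (-(1 / 2 + (1 - 4 * β) / 4))).fun_sub
    ((((hX.fun_mul hS).const_mul 3).fun_sub (hX.const_mul 2)).const_mul
      ((1 - 4 * β) / 4))).congr_deriv ?_
  simp only [resolventSech2, dispersedSech2, sech2_eq, id]
  ring

lemma memLp_dispersedSech2 (β : ℝ) : MemLp (dispersedSech2 β) 2 := by
  have h := (memLp_sech2.const_mul (1 - 4 * β)).add
    ((MemLp.mul_sech2 memLp_sech2).const_mul (6 * β))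
  refine h.ae_eq (.of_forall fun x => ?_)
  simp only [dispersedSech2, Pi.add_apply]; ring

lemma memLp_resolventSech2 (β : ℝ) : MemLp (resolventSech2 β) 2 := by
  have h := (memLp_sech2.const_mul (1 / 4)).sub
    ((MemLp.mul_tanh memLp_id_mul_sech2).const_mul ((1 - 4 * β) / 4))
  refine h.ae_eq (.of_forall fun x => ?_)
  simp [resolventSech2]; ring

lemma memLp_resolventSech2' (β : ℝ) : MemLp (resolventSech2' β) 2 := by
  have h := ((MemLp.mul_tanh memLp_sech2).const_mul (-(1 / 2 + (1 - 4 * β) / 4))).sub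
    ((((MemLp.mul_sech2 memLp_id_mul_sech2).const_mul 3).sub
      (memLp_id_mul_sech2.const_mul 2)).const_mul ((1 - 4 * β) / 4))
  refine h.ae_eq (.of_forall fun x => ?_)
  simp [resolventSech2']

lemma continuous_resolventSech2' (β : ℝ) : Continuous (resolventSech2' β) :=
  continuous_iff_continuousAt.2 fun x => (hasDerivAt_resolventSech2' β x).continuousAt

lemma integral_resolventSech2_pairing (β : ℝ) {p p' : ℝ → ℝ} (hp : ∀ x, HasDerivAt p (p' x) x)
    (hL : MemLp p 2) (hL' : MemLp p' 2) :
    Integrable (fun x => p' x * resolventSech2' β x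
      + (4 - 12 * sech2 x) * p x * resolventSech2 β x) ∧
    ∫ x, (p' x * resolventSech2' β x + (4 - 12 * sech2 x) * p x * resolventSech2 β x)
      = -∫ x, p x * dispersedSech2 β x := by
  have i1 := hL'.integrable_mul (memLp_resolventSech2' β)
  have i2 := hL.integrable_mul (memLp_resolventSech2 β)
  have i3 := hL.integrable_mul (MemLp.mul_sech2 (memLp_resolventSech2 β))
  have i4 := MemLp.integrable_fun_mul hL (memLp_dispersedSech2 β)
  have i5 : Integrable (fun x => p' x * resolventSech2' β x
      + (4 - 12 * sech2 x) * p x * resolventSech2 β x) := by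
    refine (i1.add ((i2.const_mul 4).sub (i3.const_mul 12))).congr (.of_forall fun x => ?_)
    simp; ring
  refine ⟨i5, ?_⟩
  have h := integral_eq_zero_of_hasDerivAt_of_integrable
    (fun x => (hp x).fun_mul (hasDerivAt_resolventSech2' β x))
    ((i5.add i4).congr (.of_forall fun x => by simp; ring))
    (hL.integrable_mul (memLp_resolventSech2' β))
  have h2 : ∫ x, ((p' x * resolventSech2' β x + (4 - 12 * sech2 x) * p x * resolventSech2 β x)
      + p x * dispersedSech2 β x) = 0 := by
    rw [← h]; congr 1; ext x; ring
  rw [integral_add i5 i4] at h2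
  linarith

lemma integral_resolventSech2_mul_dispersedSech2 (β : ℝ) :
    ∫ x, resolventSech2 β x * dispersedSech2 β x =
      (3 / 4 * (1 / 4 + 2 / 3 * β - 4 / 15 * β ^ 2)) * ∫ x, sech2 x ^ 2 := by
  have m3 := integral_sech2_pow_succ 1
  have x2 := integral_id_mul_tanh_mul_sech2_pow 0
  have x3 := integral_id_mul_tanh_mul_sech2_pow 1
  have i2 := integrable_sech2_pow 1
  have i3 := integrable_sech2_pow 2
  have j2 := integrable_id_mul_tanh_mul_sech2_pow 0
  have j3 := integrable_id_mul_tanh_mul_sech2_pow 1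
  norm_num at m3 x2 x3 i2 i3 j2 j3
  rw [integral_combination₄ i2 i3 j2 j3 ((1 - 4 * β) / 4) (6 * β / 4) (-((1 - 4 * β) ^ 2 / 4))
    (-((1 - 4 * β) * (6 * β) / 4)) fun x => by
      simp only [resolventSech2, dispersedSech2]; ring]
  have y3 : ∫ x, x * Real.tanh x * sech2 x ^ 3 = (∫ x, sech2 x ^ 3) / 6 := by linarith
  have y2 : ∫ x, x * Real.tanh x * sech2 x ^ 2 = (∫ x, sech2 x ^ 2) / 4 := by linarith
  have z3 : ∫ x, sech2 x ^ 3 = 4 / 5 * ∫ x, sech2 x ^ 2 := by linarith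
  rw [y3, y2, z3]
  ring

lemma integrable_form (c d : ℝ) {p p' : ℝ → ℝ} (hL : MemLp p 2) (hL' : MemLp p' 2) :
    Integrable (fun x => p' x ^ 2 + (c + d * sech2 x) * p x ^ 2) := by
  have h := ((hL'.integrable_mul hL').add ((hL.integrable_mul hL).const_mul c)).add
    ((hL.integrable_mul (MemLp.mul_sech2 hL)).const_mul d)
  refine h.congr (.of_forall fun x => ?_)
  simp; ring

/-- Lower bound for the form of `-∂² + 4 - 12 sech²` in terms of the pairing with
`(1 - β ∂²) sech²`. -/
lemma attractive_form_lower_bound {β : ℝ} {p p' : ℝ → ℝ} (hp : ∀ x, HasDerivAt p (p' x) x)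
    (hc : Continuous p') (hL : MemLp p 2) (hL' : MemLp p' 2) :
    ∃ t : ℝ, 0 ≤ (∫ x, (p' x ^ 2 + (4 + (-12) * sech2 x) * p x ^ 2))
      + 2 * t * (∫ x, p x * dispersedSech2 β x)
      - t ^ 2 * ((3 / 4 * (1 / 4 + 2 / 3 * β - 4 / 15 * β ^ 2)) * ∫ x, sech2 x ^ 2) := by
  set t : ℝ := 4 * p 0 with ht
  refine ⟨t, ?_⟩
  obtain ⟨i1, h1⟩ := integral_resolventSech2_pairing β hp hL hL'
  obtain ⟨i2, h2⟩ := integral_resolventSech2_pairing β (hasDerivAt_resolventSech2 β)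
    (memLp_resolventSech2 β) (memLp_resolventSech2' β)
  rw [integral_resolventSech2_mul_dispersedSech2] at h2
  have i0 := integrable_form 4 (-12) hL hL'
  have h := form_nonneg_of_zero (y := fun x => p x - t * resolventSech2 β x)
    (y' := fun x => p' x - t * resolventSech2' β x)
    (fun x => (hp x).fun_sub ((hasDerivAt_resolventSech2 β x).const_mul t))
    (hc.sub (continuous_const.mul (continuous_resolventSech2' β)))
    (by simp only [resolventSech2, ht, sech2, Real.cosh_zero]; ring)
    (hL.sub ((memLp_resolventSech2 β).const_mul t))
    (hL'.sub ((memLp_resolventSech2' β).const_mul t))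
  rw [integral_combination₃ i0 i1 i2 1 (-(2 * t)) (t ^ 2) fun x => by ring, h1, h2] at h
  linarith

/-- Lower bound for the form of `-∂² + 4 + 6 sech²` in terms of the pairing with
`(1 - β ∂²) sech²`. -/
lemma repulsive_form_lower_bound {β : ℝ} {q q' : ℝ → ℝ} (hq : ∀ x, HasDerivAt q (q' x) x)
    (hL : MemLp q 2) (hL' : MemLp q' 2) (t : ℝ) :
    0 ≤ (∫ x, (q' x ^ 2 + (4 + 6 * sech2 x) * q x ^ 2))
      - 2 * t * (∫ x, q x * dispersedSech2 β x)
      + t ^ 2 * ((3 / 4 * (1 / 3 + 1 / 15 * β + 3 / 7 * β ^ 2)) * ∫ x, sech2 x ^ 2) := by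
  have m3 := integral_sech2_pow_succ 1
  have m4 := integral_sech2_pow_succ 2
  have j2 := integrable_sech2_pow 1
  have j3 := integrable_sech2_pow 2
  have j4 := integrable_sech2_pow 3
  norm_num at m3 m4 j2 j3 j4
  have z3 : ∫ x, sech2 x ^ 3 = 4 / 5 * ∫ x, sech2 x ^ 2 := by linarith
  have z4 : ∫ x, sech2 x ^ 4 = 24 / 35 * ∫ x, sech2 x ^ 2 := by linarith
  have i0 := integrable_form 4 6 hL hL'
  have i1 := MemLp.integrable_fun_mul hL (memLp_dispersedSech2 β)
  have hT := MemLp.mul_tanh memLp_sech2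
  have hS2 := MemLp.mul_sech2 memLp_sech2
  have hd : ∀ x, HasDerivAt (fun x => q x * (-2 * Real.tanh x * sech2 x))
      (-2 * (q' x * (sech2 x * Real.tanh x)) + q x * (4 * sech2 x - 6 * sech2 x ^ 2)) x :=
    fun x => by
      refine ((hq x).fun_mul (((hasDerivAt_tanh x).const_mul (-2)).fun_mul
        (hasDerivAt_sech2 x))).congr_deriv ?_
      simp only [sech2_eq]; ring
  have i2 : Integrable fun x =>
      -2 * (q' x * (sech2 x * Real.tanh x)) + q x * (4 * sech2 x - 6 * sech2 x ^ 2) := by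
    refine (((hL'.integrable_mul hT).const_mul (-2)).add
      (((hL.integrable_mul memLp_sech2).const_mul 4).sub
        ((hL.integrable_mul hS2).const_mul 6))).congr (.of_forall fun x => ?_)
    simp; ring
  have h2 := integral_eq_zero_of_hasDerivAt_of_integrable hd i2
    (((hL.integrable_mul hT).const_mul (-2)).congr (.of_forall fun x => by simp; ring))
  have h : 0 ≤ ∫ x, ((2 * q x - t * ((1 / 2 - 7 / 4 * β) * sech2 x + 9 / 4 * β * sech2 x ^ 2)) ^ 2
      + (q' x - t * (-(β / 4) * (sech2 x * Real.tanh x))) ^ 2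
      + 6 * sech2 x * (q x - t * (β / 8 * sech2 x)) ^ 2) :=
    integral_nonneg fun x => by
      have := sech2_pos x
      simp only [Pi.zero_apply]
      positivity
  have k : Integrable fun x =>
      ((1 / 2 - 7 / 4 * β) ^ 2 + β ^ 2 / 16) * sech2 x ^ 2
        + (2 * (1 / 2 - 7 / 4 * β) * (9 / 4 * β) + β ^ 2 / 32) * sech2 x ^ 3
        + (9 / 4 * β) ^ 2 * sech2 x ^ 4 :=
    ((j2.const_mul _).add (j3.const_mul _)).add (j4.const_mul _)
  rw [integral_combination₄ i0 i1 i2 k 1 (-(2 * t)) (-(t * β / 4)) (t ^ 2) fun x => by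
    simp only [dispersedSech2, sech2_eq]; ring, h2,
    integral_combination₃ j2 j3 j4 _ _ _ fun _ => rfl, z3, z4] at h
  linarith

/-- Nonnegativity, and partial strictness, of the diagonalized energy under the symplectic
orthogonality constraint. -/
lemma constrained_energy {β s : ℝ} (hβ : 0 < β) (hβ' : β < 2001 / 1000) (hs : s ^ 2 = 2)
    {p p' q q' : ℝ → ℝ} (hp : ∀ x, HasDerivAt p (p' x) x) (hc : Continuous p')
    (hq : ∀ x, HasDerivAt q (q' x) x) (hpL : MemLp p 2) (hpL' : MemLp p' 2)
    (hqL : MemLp q 2) (hqL' : MemLp q' 2)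
    (horth : ∫ x, (2 * s * p x + q x) * dispersedSech2 β x = 0) :
    0 ≤ (∫ x, (p' x ^ 2 + (4 + (-12) * sech2 x) * p x ^ 2))
      + (∫ x, (q' x ^ 2 + (4 + 6 * sech2 x) * q x ^ 2)) ∧
    ((∫ x, (p' x ^ 2 + (4 + (-12) * sech2 x) * p x ^ 2))
      + (∫ x, (q' x ^ 2 + (4 + 6 * sech2 x) * q x ^ 2)) = 0 → ∀ x, q x = 0) := by
  obtain ⟨t, hP⟩ := attractive_form_lower_bound (β := β) hp hc hpL hpL'
  have hQ := repulsive_form_lower_bound (β := β) hq hqL hqL'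
  have ip := MemLp.integrable_fun_mul hpL (memLp_dispersedSech2 β)
  have iq := MemLp.integrable_fun_mul hqL (memLp_dispersedSech2 β)
  have hX : ∫ x, (2 * s * p x + q x) * dispersedSech2 β x =
      2 * s * (∫ x, p x * dispersedSech2 β x) + ∫ x, q x * dispersedSech2 β x := by
    rw [← integral_const_mul, ← integral_add (ip.const_mul _) iq]
    congr 1; ext x; ring
  rw [horth] at hX
  have hJ : 0 < ∫ x, sech2 x ^ 2 := by
    have hi := integrable_sech2_pow 1
    norm_num at hi
    rw [integral_pos_iff_support_of_nonneg (fun x => sq_nonneg _) hi]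
    have : Function.support (fun x => sech2 x ^ 2) = univ := by
      ext x; simp [(sech2_pos x).ne']
    simp [this]
  have hQ0 : ∀ x, 0 ≤ q' x ^ 2 + (4 + 6 * sech2 x) * q x ^ 2 := fun x => by
    have := sech2_pos x
    positivity
  have hEQ : 0 ≤ ∫ x, (q' x ^ 2 + (4 + 6 * sech2 x) * q x ^ 2) := integral_nonneg hQ0
  have hzero : ∫ x, (q' x ^ 2 + (4 + 6 * sech2 x) * q x ^ 2) = 0 → ∀ x, q x = 0 := by
    intro h0
    have hi := integrable_form 4 6 hqL hqL'
    have h1 := (integral_eq_zero_iff_of_nonneg hQ0 hi).1 h0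
    have h2 : q =ᵐ[volume] fun _ => 0 := by
      filter_upwards [h1] with x hx
      have hx : q' x ^ 2 + (4 + 6 * sech2 x) * q x ^ 2 = 0 := hx
      have := sech2_pos x
      have : q x ^ 2 = 0 := by nlinarith [sq_nonneg (q' x), sq_nonneg (q x)]
      simpa using this
    have hqc : Continuous q := continuous_iff_continuousAt.2 fun x => (hq x).continuousAt
    exact congrFun (Measure.eq_of_ae_eq h2 hqc continuous_const)
  set EP := ∫ x, (p' x ^ 2 + (4 + (-12) * sech2 x) * p x ^ 2)
  set EQ := ∫ x, (q' x ^ 2 + (4 + 6 * sech2 x) * q x ^ 2)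
  set X := ∫ x, p x * dispersedSech2 β x
  set Y := ∫ x, q x * dispersedSech2 β x
  set J := ∫ x, sech2 x ^ 2
  set N := (3 / 4 * (1 / 4 + 2 / 3 * β - 4 / 15 * β ^ 2)) * J with hN
  set M := (3 / 4 * (1 / 3 + 1 / 15 * β + 3 / 7 * β ^ 2)) * J with hM
  have hNpos : 0 < N := mul_pos (by nlinarith) hJ
  have hMpos : 0 < M := by positivity
  have hNM : 0 < 8 * N - M := by
    have : 8 * N - M = (3 / 4 * (5 / 3 + 79 / 15 * β - 269 / 105 * β ^ 2)) * J := by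
      rw [hN, hM]; ring
    rw [this]
    exact mul_pos (by nlinarith) hJ
  have hY : Y = -2 * s * X := by linarith
  have hYX : Y ^ 2 = 8 * X ^ 2 := by rw [hY]; linear_combination 4 * X ^ 2 * hs
  have h1 : Y ^ 2 ≤ EQ * M := by
    have h := hQ (Y / M)
    have e : EQ - 2 * (Y / M) * Y + (Y / M) ^ 2 * M = EQ - Y ^ 2 / M := by
      field_simp; ring
    rw [e, sub_nonneg, div_le_iff₀ hMpos] at h
    exact h
  have h2 : -X ^ 2 ≤ EP * N := by nlinarith [sq_nonneg (t * N - X)]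
  have h3 : EQ * (8 * N - M) ≤ 8 * N * (EP + EQ) := by nlinarith
  have h4 := mul_nonneg hEQ hNM.le
  refine ⟨?_, fun h0 => hzero ?_⟩
  · exact (mul_nonneg_iff_of_pos_left (by positivity : 0 < 8 * N)).1 (h4.trans h3)
  · rw [h0, mul_zero] at h3
    exact (mul_eq_zero.1 (le_antisymm h3 h4)).resolve_right hNM.ne'

lemma MemLp.conj_complex {f : ℝ → ℂ} (hf : MemLp f 2) :
    MemLp (fun x => (starRingEnd ℂ) (f x)) 2 :=
  hf.star

lemma HasDerivAt.conj_complex {f : ℝ → ℂ} {f' : ℂ} {x : ℝ} (hf : HasDerivAt f f' x) :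
    HasDerivAt (fun x => (starRingEnd ℂ) (f x)) ((starRingEnd ℂ) f') x :=
  hf.star

lemma MemLp.integrable_mul_complex {f g : ℝ → ℂ} (hf : MemLp f 2) (hg : MemLp g 2) :
    Integrable fun x => f x * g x :=
  hf.integrable_mul hg

lemma MemLp.mul_sech2_complex {f : ℝ → ℂ} (hf : MemLp f 2) :
    MemLp (fun x => f x * (sech2 x : ℂ)) 2 := by
  refine hf.of_le (hf.1.mul (Complex.continuous_ofReal.comp
    continuous_sech2).aestronglyMeasurable) (.of_forall fun x => ?_)
  rw [norm_mul, Complex.norm_real]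
  refine mul_le_of_le_one_right (norm_nonneg _) ?_
  rw [Real.norm_of_nonneg (sech2_pos x).le]
  exact sech2_le_one x

lemma MemLp.mul_tanh_complex {f : ℝ → ℂ} (hf : MemLp f 2) :
    MemLp (fun x => f x * (Real.tanh x : ℂ)) 2 := by
  refine hf.of_le (hf.1.mul (Complex.continuous_ofReal.comp
    continuous_tanh').aestronglyMeasurable) (.of_forall fun x => ?_)
  rw [norm_mul, Complex.norm_real]
  exact mul_le_of_le_one_right (norm_nonneg _) (abs_tanh_le_one x)

lemma memLp_sech2_complex : MemLp (fun x => (sech2 x : ℂ)) 2 := memLp_sech2.ofReal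

/-- For an eigenvalue off the imaginary axis the (real) energy of an eigenfunction vanishes. -/
lemma energy_eq_zero {β E : ℝ} {lam : ℂ} (hlam : 0 < lam.re) {v v' v'' z z' z'' A B : ℝ → ℂ}
    (hv : ∀ x, HasDerivAt v (v' x) x) (hv' : ∀ x, HasDerivAt v' (v'' x) x)
    (hz : ∀ x, HasDerivAt z (z' x) x) (hz' : ∀ x, HasDerivAt z' (z'' x) x)
    (hA : ∀ x, HasDerivAt A (-(lam * (v x - β * v'' x))) x)
    (hB : ∀ x, HasDerivAt B (-(lam * (z x - β * z'' x))) x)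
    (Lv : MemLp v 2) (Lv' : MemLp v' 2) (Lz : MemLp z 2) (Lz' : MemLp z' 2)
    (LA : MemLp A 2) (LB : MemLp B 2)
    (hE : ∫ x, (B x * (starRingEnd ℂ) (v x) + A x * (starRingEnd ℂ) (z x)) = (E : ℂ)) :
    E = 0 := by
  have hlam0 : lam ≠ 0 := fun h => by simp [h] at hlam
  set V : ℝ → ℂ := fun x => β * v' x - lam⁻¹ * A x with hV
  set Z : ℝ → ℂ := fun x => β * z' x - lam⁻¹ * B x with hZ
  have dV : ∀ x, HasDerivAt V (v x) x := fun x => by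
    refine (((hv' x).const_mul (β : ℂ)).fun_sub ((hA x).const_mul lam⁻¹)).congr_deriv ?_
    field_simp; ring
  have dZ : ∀ x, HasDerivAt Z (z x) x := fun x => by
    refine (((hz' x).const_mul (β : ℂ)).fun_sub ((hB x).const_mul lam⁻¹)).congr_deriv ?_
    field_simp; ring
  have LV : MemLp V 2 := (Lv'.const_mul (β : ℂ)).sub (LA.const_mul lam⁻¹)
  have LZ : MemLp Z 2 := (Lz'.const_mul (β : ℂ)).sub (LB.const_mul lam⁻¹)
  set Q : ℝ → ℂ := fun x => B x * (starRingEnd ℂ) (v x) + A x * (starRingEnd ℂ) (z x) with hQ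
  have iQ : Integrable Q := (MemLp.integrable_mul_complex LB (MemLp.conj_complex Lv)).add
    (MemLp.integrable_mul_complex LA (MemLp.conj_complex Lz))
  have iQc : Integrable fun x => (starRingEnd ℂ) (Q x) :=
    Complex.conjLIE.toContinuousLinearEquiv.toContinuousLinearMap.integrable_comp iQ
  have hd : ∀ x, HasDerivAt
      (fun x => β * (z x * (starRingEnd ℂ) (v x) + v x * (starRingEnd ℂ) (z x))
        - (Z x * (starRingEnd ℂ) (V x) + V x * (starRingEnd ℂ) (Z x)))
      (lam⁻¹ * Q x + (starRingEnd ℂ) lam⁻¹ * (starRingEnd ℂ) (Q x)) x := fun x => by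
    refine (((((hz x).fun_mul (hv x).conj_complex).fun_add
      ((hv x).fun_mul (hz x).conj_complex)).const_mul (β : ℂ)).fun_sub
      (((dZ x).fun_mul (dV x).conj_complex).fun_add
        ((dV x).fun_mul (dZ x).conj_complex))).congr_deriv ?_
    simp only [hQ, hV, hZ, map_add, map_mul, map_sub, Complex.conj_conj, Complex.conj_ofReal]
    ring
  have h := integral_eq_zero_of_hasDerivAt_of_integrable hd
    ((iQ.const_mul _).add (iQc.const_mul _)) (by
      refine (((MemLp.integrable_mul_complex Lz (MemLp.conj_complex Lv)).add
        (MemLp.integrable_mul_complex Lv (MemLp.conj_complex Lz))).const_mul _).sub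
        ((MemLp.integrable_mul_complex LZ (MemLp.conj_complex LV)).add
        (MemLp.integrable_mul_complex LV (MemLp.conj_complex LZ))))
  rw [integral_add (iQ.const_mul _) (iQc.const_mul _), integral_const_mul, integral_const_mul,
    integral_conj, hE, Complex.conj_ofReal, ← add_mul, Complex.add_conj] at h
  rcases mul_eq_zero.1 h with h | h
  · rw [Complex.ofReal_eq_zero, Complex.inv_re] at h
    have : 0 < lam.re / Complex.normSq lam := div_pos hlam (Complex.normSq_pos.2 hlam0)
    linarith
  · exact_mod_cast h

lemma hasDerivAt_sech2_complex (x : ℝ) :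
    HasDerivAt (fun x => (sech2 x : ℂ)) (-2 * Real.tanh x * sech2 x : ℂ) x := by
  simpa using (hasDerivAt_sech2 x).ofReal_comp

lemma hasDerivAt_tanh_complex (x : ℝ) :
    HasDerivAt (fun x => (Real.tanh x : ℂ)) (sech2 x : ℂ) x :=
  (hasDerivAt_tanh x).ofReal_comp

/-- Eigenfunctions for nonzero eigenvalues are symplectically orthogonal to the translation
mode. -/
lemma symplectic_orthogonality {β s : ℝ} (hs : s ^ 2 = 2) {lam : ℂ} (hlam : lam ≠ 0)
    {v v' v'' z z' z'' A B : ℝ → ℂ}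
    (hv : ∀ x, HasDerivAt v (v' x) x) (hv' : ∀ x, HasDerivAt v' (v'' x) x)
    (hz : ∀ x, HasDerivAt z (z' x) x) (hz' : ∀ x, HasDerivAt z' (z'' x) x)
    (hA : ∀ x, HasDerivAt A (-(lam * (v x - β * v'' x))) x)
    (hB : ∀ x, HasDerivAt B (-(lam * (z x - β * z'' x))) x)
    (Lv : MemLp v 2) (Lv' : MemLp v' 2) (Lz : MemLp z 2) (Lz' : MemLp z' 2)
    (LA : MemLp A 2) (LB : MemLp B 2)
    (eA : ∀ x, A x = 3 / 2 * s * sech2 x * v x + z x - z'' x / 4 - 3 / 2 * sech2 x * z x)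
    (eB : ∀ x, B x = v x - v'' x / 4 + 3 / 2 * s * sech2 x * z x) :
    ∫ x, (s * v x - z x) * (dispersedSech2 β x : ℂ) = 0 := by
  have hs' : (s : ℂ) ^ 2 = 2 := by exact_mod_cast hs
  set p : ℝ → ℂ := fun x => v x - s * z x with hp
  set p' : ℝ → ℂ := fun x => v' x - s * z' x with hp'
  set w : ℝ → ℂ := fun x => s * v x - z x with hw
  set w' : ℝ → ℂ := fun x => s * v' x - z' x with hw'
  have dp : ∀ x, HasDerivAt p (p' x) x := fun x => (hv x).fun_sub ((hz x).const_mul _)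
  have dp' : ∀ x, HasDerivAt p' (v'' x - s * z'' x) x :=
    fun x => (hv' x).fun_sub ((hz' x).const_mul _)
  have dw : ∀ x, HasDerivAt w (w' x) x := fun x => ((hv x).const_mul _).fun_sub (hz x)
  have dw' : ∀ x, HasDerivAt w' (s * v'' x - z'' x) x :=
    fun x => ((hv' x).const_mul _).fun_sub (hz' x)
  have Lp : MemLp p 2 := Lv.sub (Lz.const_mul _)
  have Lp' : MemLp p' 2 := Lv'.sub (Lz'.const_mul _)
  have Lw : MemLp w 2 := (Lv.const_mul _).sub Lz
  have Lw' : MemLp w' 2 := (Lv'.const_mul _).sub Lz'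
  have Lg : MemLp (fun x => (dispersedSech2 β x : ℂ)) 2 := (memLp_dispersedSech2 β).ofReal
  have hT : ∀ x, (Real.tanh x : ℂ) ^ 2 = 1 - sech2 x := fun x => by
    have : Real.tanh x ^ 2 = 1 - sech2 x := by rw [sech2_eq]; ring
    exact_mod_cast this
  have hd : ∀ x, HasDerivAt (fun x => (B x - s * A x) * sech2 x
      + 1 / 4 * (p' x * (-2 * Real.tanh x * sech2 x)
        - p x * (4 * sech2 x - 6 * (sech2 x * sech2 x)))
      + lam * β * (w' x * sech2 x - w x * (-2 * Real.tanh x * sech2 x)))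
      (lam * (w x * (dispersedSech2 β x : ℂ))) x := fun x => by
    have dS := hasDerivAt_sech2_complex x
    have dT := hasDerivAt_tanh_complex x
    have dS' := (dT.const_mul (-2)).fun_mul dS
    refine ((((hB x).fun_sub ((hA x).const_mul (s : ℂ))).fun_mul dS).fun_add
      ((((dp' x).fun_mul dS').fun_sub ((dp x).fun_mul ((dS.const_mul 4).fun_sub
        ((dS.fun_mul dS).const_mul 6)))).const_mul (1 / 4)) |>.fun_add
      ((((dw' x).fun_mul dS).fun_sub ((dw x).fun_mul dS')).const_mul
        (lam * β))).congr_deriv ?_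
    simp only [eA, eB, hp, hp', hw, hw', dispersedSech2]
    push_cast [-Complex.ofReal_tanh]
    have h1 := hT x
    generalize (Real.tanh x : ℂ) = T at *
    generalize (sech2 x : ℂ) = S at *
    obtain rfl : S = 1 - T ^ 2 := by linear_combination h1
    linear_combination (3 * T * (1 - T ^ 2) ^ 2 * v x) * hs'
  have h := integral_eq_zero_of_hasDerivAt_of_integrable hd
    ((MemLp.integrable_mul_complex Lw Lg).const_mul lam) (by
      have m1 := MemLp.integrable_mul_complex (LB.sub (LA.const_mul (s : ℂ))) memLp_sech2_complex
      have m2 := MemLp.integrable_mul_complex (MemLp.mul_tanh_complex Lp') memLp_sech2_complex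
      have m3 := MemLp.integrable_mul_complex Lp memLp_sech2_complex
      have m4 := MemLp.integrable_mul_complex (MemLp.mul_sech2_complex Lp) memLp_sech2_complex
      have m5 := MemLp.integrable_mul_complex Lw' memLp_sech2_complex
      have m6 := MemLp.integrable_mul_complex (MemLp.mul_tanh_complex Lw) memLp_sech2_complex
      refine (((m1.add (m2.const_mul (-1 / 2))).add ((m3.const_mul (-1)).add
        (m4.const_mul (3 / 2)))).add ((m5.const_mul (lam * β)).add
        (m6.const_mul (2 * lam * β)))).congr (.of_forall fun x => ?_)
      simp only [Pi.add_apply, Pi.sub_apply]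
      ring)
  rw [integral_const_mul] at h
  exact (mul_eq_zero.1 h).resolve_left hlam

/-- The constrained energy inequality for a real component of complex-valued functions. -/
lemma constrained_energy_component {β s : ℝ} (hβ : 0 < β) (hβ' : β < 2001 / 1000)
    (hs : s ^ 2 = 2) (l : ℂ →L[ℝ] ℝ) {p p' p'' q q' : ℝ → ℂ}
    (hp : ∀ x, HasDerivAt p (p' x) x) (hp' : ∀ x, HasDerivAt p' (p'' x) x)
    (hq : ∀ x, HasDerivAt q (q' x) x) (hpL : MemLp p 2) (hpL' : MemLp p' 2)
    (hqL : MemLp q 2) (hqL' : MemLp q' 2)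
    (horth : ∫ x, (2 * s * p x + q x) * (dispersedSech2 β x : ℂ) = 0) :
    0 ≤ (∫ x, (l (p' x) ^ 2 + (4 + (-12) * sech2 x) * l (p x) ^ 2))
      + (∫ x, (l (q' x) ^ 2 + (4 + 6 * sech2 x) * l (q x) ^ 2)) ∧
    ((∫ x, (l (p' x) ^ 2 + (4 + (-12) * sech2 x) * l (p x) ^ 2))
      + (∫ x, (l (q' x) ^ 2 + (4 + 6 * sech2 x) * l (q x) ^ 2)) = 0 → ∀ x, l (q x) = 0) := by
  have hcp' : Continuous p' := continuous_iff_continuousAt.2 fun x => (hp' x).continuousAt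
  refine constrained_energy hβ hβ' hs (fun x => l.hasFDerivAt.comp_hasDerivAt x (hp x))
    (l.continuous.comp hcp') (fun x => l.hasFDerivAt.comp_hasDerivAt x (hq x))
    (l.comp_memLp' hpL) (l.comp_memLp' hpL') (l.comp_memLp' hqL) (l.comp_memLp' hqL') ?_
  have hi : Integrable fun x => (2 * s * p x + q x) * (dispersedSech2 β x : ℂ) :=
    MemLp.integrable_mul_complex ((hpL.const_mul (2 * s : ℂ)).add hqL)
      (memLp_dispersedSech2 β).ofReal
  have h := l.integral_comp_comm hi
  rw [horth, map_zero] at h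
  rw [← h]
  congr 1; ext x
  have e : (2 * s * p x + q x) * (dispersedSech2 β x : ℂ)
      = dispersedSech2 β x • ((2 * s) • p x + q x) := by
    simp only [Complex.real_smul]; push_cast; ring
  rw [e, map_smul, map_add, map_smul]
  simp only [smul_eq_mul]; ring

/-- Rotating to the diagonal variables turns the energy of an eigenfunction into a sum of
real quadratic forms. -/
lemma integral_energy_eq {s : ℝ} (hs : s ^ 2 = 2) {v v' v'' z z' z'' A B : ℝ → ℂ}
    (hv : ∀ x, HasDerivAt v (v' x) x) (hv' : ∀ x, HasDerivAt v' (v'' x) x)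
    (hz : ∀ x, HasDerivAt z (z' x) x) (hz' : ∀ x, HasDerivAt z' (z'' x) x)
    (Lv : MemLp v 2) (Lv' : MemLp v' 2) (Lz : MemLp z 2) (Lz' : MemLp z' 2)
    (LA : MemLp A 2) (LB : MemLp B 2)
    (eA : ∀ x, A x = 3 / 2 * s * sech2 x * v x + z x - z'' x / 4 - 3 / 2 * sech2 x * z x)
    (eB : ∀ x, B x = v x - v'' x / 4 + 3 / 2 * s * sech2 x * z x) {R : ℝ → ℝ}
    (hR : ∀ x, 12 * R x =
      (v' x - s * z' x).re ^ 2 + (4 + (-12) * sech2 x) * (v x - s * z x).re ^ 2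
      + ((s * v' x + z' x).re ^ 2 + (4 + 6 * sech2 x) * (s * v x + z x).re ^ 2)
      + ((v' x - s * z' x).im ^ 2 + (4 + (-12) * sech2 x) * (v x - s * z x).im ^ 2
      + ((s * v' x + z' x).im ^ 2 + (4 + 6 * sech2 x) * (s * v x + z x).im ^ 2)))
    (hRi : Integrable R) :
    ∫ x, (B x * (starRingEnd ℂ) (v x) + A x * (starRingEnd ℂ) (z x)) = ((∫ x, R x : ℝ) : ℂ) := by
  have iQ : Integrable fun x => B x * (starRingEnd ℂ) (v x) + A x * (starRingEnd ℂ) (z x) :=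
    (MemLp.integrable_mul_complex LB (MemLp.conj_complex Lv)).add
    (MemLp.integrable_mul_complex LA (MemLp.conj_complex Lz))
  have iR : Integrable fun x => (R x : ℂ) := hRi.ofReal
  have hd : ∀ x, HasDerivAt
      (fun x => 1 / 4 * (v' x * (starRingEnd ℂ) (v x) + z' x * (starRingEnd ℂ) (z x)))
      ((R x : ℂ) - (B x * (starRingEnd ℂ) (v x) + A x * (starRingEnd ℂ) (z x))) x := fun x => by
    refine ((((hv' x).fun_mul (hv x).conj_complex).fun_add
      ((hz' x).fun_mul (hz x).conj_complex)).const_mul (1 / 4)).congr_deriv ?_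
    have h := hR x
    have hR' : R x = ((v' x).re * (v' x).re + (v' x).im * (v' x).im + (z' x).re * (z' x).re + (z' x).im * (z' x).im) / 4
        + ((v x).re * (v x).re + (v x).im * (v x).im + (z x).re * (z x).re + (z x).im * (z x).im)
        + 3 * s * sech2 x * ((v x).re * (z x).re + (v x).im * (z x).im)
        - 3 / 2 * sech2 x * ((z x).re * (z x).re + (z x).im * (z x).im) := by
      simp only [Complex.add_re, Complex.sub_re, Complex.re_ofReal_mul, Complex.add_im,
        Complex.sub_im, Complex.im_ofReal_mul] at h
      linear_combination h / 12 + ((z' x).re ^ 2 + (z' x).im ^ 2 + (v' x).re ^ 2 + (v' x).im ^ 2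
        + (4 - 12 * sech2 x) * ((z x).re ^ 2 + (z x).im ^ 2)
        + (4 + 6 * sech2 x) * ((v x).re ^ 2 + (v x).im ^ 2)) / 12 * hs
    rw [eA, eB, hR']
    apply Complex.ext
    · simp; ring
    · simp; ring
  have h := integral_eq_zero_of_hasDerivAt_of_integrable hd (iR.sub iQ)
    (((MemLp.integrable_mul_complex Lv' (MemLp.conj_complex Lv)).add
      (MemLp.integrable_mul_complex Lz' (MemLp.conj_complex Lz))).const_mul _)
  rw [integral_sub iR iQ, sub_eq_zero] at h
  rw [← h, integral_complex_ofReal]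

/-- A square-integrable solution of `v = β ∂²v` with `β > 0` vanishes. -/
lemma eq_zero_of_eq_mul_second_deriv {β : ℝ} (hβ : 0 < β) {v v' v'' : ℝ → ℂ}
    (hv : ∀ x, HasDerivAt v (v' x) x) (hv' : ∀ x, HasDerivAt v' (v'' x) x)
    (Lv : MemLp v 2) (Lv' : MemLp v' 2) (h : ∀ x, v x = β * v'' x) (x : ℝ) : v x = 0 := by
  have hnn : ∀ x, 0 ≤ ‖v x‖ ^ 2 + β * ‖v' x‖ ^ 2 := fun x => by positivity
  have hi : Integrable fun x => ‖v x‖ ^ 2 + β * ‖v' x‖ ^ 2 :=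
    ((memLp_two_iff_integrable_sq_norm Lv.1).1 Lv).add
      (((memLp_two_iff_integrable_sq_norm Lv'.1).1 Lv').const_mul β)
  have hd : ∀ x, HasDerivAt (fun x => β * (v' x * (starRingEnd ℂ) (v x)))
      ((‖v x‖ ^ 2 + β * ‖v' x‖ ^ 2 : ℝ) : ℂ) x := fun x => by
    refine (((hv' x).fun_mul (hv x).conj_complex).const_mul (β : ℂ)).congr_deriv ?_
    push_cast
    rw [← Complex.mul_conj', ← Complex.mul_conj']
    linear_combination -(starRingEnd ℂ) (v x) * h x
  have h0 := integral_eq_zero_of_hasDerivAt_of_integrable hd hi.ofReal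
    ((MemLp.integrable_mul_complex Lv' (MemLp.conj_complex Lv)).const_mul _)
  rw [integral_complex_ofReal, Complex.ofReal_eq_zero] at h0
  have h1 := (integral_eq_zero_iff_of_nonneg hnn hi).1 h0
  have h2 : v =ᵐ[volume] fun _ => 0 := by
    filter_upwards [h1] with x hx
    have hx : ‖v x‖ ^ 2 + β * ‖v' x‖ ^ 2 = 0 := hx
    have : ‖v x‖ ^ 2 = 0 := by nlinarith [sq_nonneg ‖v x‖, mul_nonneg hβ.le (sq_nonneg ‖v' x‖)]
    simpa using this
  exact congrFun (Measure.eq_of_ae_eq h2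
    (continuous_iff_continuousAt.2 fun x => (hv x).continuousAt) continuous_const) x

/-- There is no unstable eigenfunction in the normalization `a = -1/4`. -/
lemma eigenfunction_eq_zero {β s : ℝ} (hβ : 0 < β) (hβ' : β < 2001 / 1000) (hs : s ^ 2 = 2)
    {lam : ℂ} (hlam : 0 < lam.re) {v v' v'' z z' z'' A B : ℝ → ℂ}
    (hv : ∀ x, HasDerivAt v (v' x) x) (hv' : ∀ x, HasDerivAt v' (v'' x) x)
    (hz : ∀ x, HasDerivAt z (z' x) x) (hz' : ∀ x, HasDerivAt z' (z'' x) x)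
    (hA : ∀ x, HasDerivAt A (-(lam * (v x - β * v'' x))) x)
    (hB : ∀ x, HasDerivAt B (-(lam * (z x - β * z'' x))) x)
    (Lv : MemLp v 2) (Lv' : MemLp v' 2) (Lv'' : MemLp v'' 2)
    (Lz : MemLp z 2) (Lz' : MemLp z' 2) (Lz'' : MemLp z'' 2)
    (eA : ∀ x, A x = 3 / 2 * s * sech2 x * v x + z x - z'' x / 4 - 3 / 2 * sech2 x * z x)
    (eB : ∀ x, B x = v x - v'' x / 4 + 3 / 2 * s * sech2 x * z x) (x : ℝ) :
    v x = 0 ∧ z x = 0 := by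
  have hlam0 : lam ≠ 0 := fun h => by simp [h] at hlam
  have hs' : (s : ℂ) ^ 2 = 2 := by exact_mod_cast hs
  have LA : MemLp A 2 := by
    refine MemLp.ae_eq (.of_forall fun x => ?_)
      ((((MemLp.mul_sech2_complex Lv).const_mul (3 / 2 * s : ℂ)).add Lz).sub
        ((Lz''.const_mul (1 / 4 : ℂ)).add ((MemLp.mul_sech2_complex Lz).const_mul (3 / 2 : ℂ))))
    simp only [eA, Pi.add_apply, Pi.sub_apply]
    ring
  have LB : MemLp B 2 := by
    refine MemLp.ae_eq (.of_forall fun x => ?_)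
      ((Lv.sub (Lv''.const_mul (1 / 4 : ℂ))).add
        ((MemLp.mul_sech2_complex Lz).const_mul (3 / 2 * s : ℂ)))
    simp only [eB, Pi.add_apply, Pi.sub_apply]
    ring
  have horth : ∫ x, (2 * s * (v x - s * z x) + (s * v x + z x)) * (dispersedSech2 β x : ℂ) = 0 := by
    have h := symplectic_orthogonality hs hlam0 hv hv' hz hz' hA hB Lv Lv' Lz Lz' LA LB eA eB
    have e : ∀ x, (2 * s * (v x - s * z x) + (s * v x + z x)) * (dispersedSech2 β x : ℂ)
        = 3 * ((s * v x - z x) * (dispersedSech2 β x : ℂ)) := fun x => by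
      linear_combination (-2 * z x * (dispersedSech2 β x : ℂ)) * hs'
    simp_rw [e]
    rw [integral_const_mul, h, mul_zero]
  have dp : ∀ x, HasDerivAt (fun x => v x - s * z x) (v' x - s * z' x) x :=
    fun x => (hv x).fun_sub ((hz x).const_mul _)
  have dp' : ∀ x, HasDerivAt (fun x => v' x - s * z' x) (v'' x - s * z'' x) x :=
    fun x => (hv' x).fun_sub ((hz' x).const_mul _)
  have dq : ∀ x, HasDerivAt (fun x => s * v x + z x) (s * v' x + z' x) x :=
    fun x => ((hv x).const_mul _).fun_add (hz x)
  have Lp : MemLp (fun x => v x - s * z x) 2 := Lv.sub (Lz.const_mul _)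
  have Lp' : MemLp (fun x => v' x - s * z' x) 2 := Lv'.sub (Lz'.const_mul _)
  have Lq : MemLp (fun x => s * v x + z x) 2 := (Lv.const_mul _).add Lz
  have Lq' : MemLp (fun x => s * v' x + z' x) 2 := (Lv'.const_mul _).add Lz'
  have hcomp := fun l : ℂ →L[ℝ] ℝ =>
    constrained_energy_component hβ hβ' hs l dp dp' dq Lp Lp' Lq Lq' horth
  obtain ⟨hre, hre0⟩ := hcomp Complex.reCLM
  obtain ⟨him, him0⟩ := hcomp Complex.imCLM
  have i1 : ∀ l : ℂ →L[ℝ] ℝ, Integrable fun x =>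
      l (v' x - s * z' x) ^ 2 + (4 + (-12) * sech2 x) * l (v x - s * z x) ^ 2 :=
    fun l => integrable_form 4 (-12) (l.comp_memLp' Lp) (l.comp_memLp' Lp')
  have i2 : ∀ l : ℂ →L[ℝ] ℝ, Integrable fun x =>
      l (s * v' x + z' x) ^ 2 + (4 + 6 * sech2 x) * l (s * v x + z x) ^ 2 :=
    fun l => integrable_form 4 6 (l.comp_memLp' Lq) (l.comp_memLp' Lq')
  have hsum : (∫ x, ((Complex.reCLM (v' x - s * z' x)) ^ 2
      + (4 + (-12) * sech2 x) * (Complex.reCLM (v x - s * z x)) ^ 2))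
      + (∫ x, ((Complex.reCLM (s * v' x + z' x)) ^ 2
      + (4 + 6 * sech2 x) * (Complex.reCLM (s * v x + z x)) ^ 2))
      + ((∫ x, ((Complex.imCLM (v' x - s * z' x)) ^ 2
      + (4 + (-12) * sech2 x) * (Complex.imCLM (v x - s * z x)) ^ 2))
      + (∫ x, ((Complex.imCLM (s * v' x + z' x)) ^ 2
      + (4 + 6 * sech2 x) * (Complex.imCLM (s * v x + z x)) ^ 2))) = 0 := by
    have i12 : ∀ l : ℂ →L[ℝ] ℝ, Integrable fun x =>
        l (v' x - s * z' x) ^ 2 + (4 + (-12) * sech2 x) * l (v x - s * z x) ^ 2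
        + (l (s * v' x + z' x) ^ 2 + (4 + 6 * sech2 x) * l (s * v x + z x) ^ 2) :=
      fun l => (i1 l).add (i2 l)
    have hi := (i12 Complex.reCLM).add (i12 Complex.imCLM)
    have hE := energy_eq_zero hlam hv hv' hz hz' hA hB Lv Lv' Lz Lz' LA LB
      (integral_energy_eq hs hv hv' hz hz' Lv Lv' Lz Lz' LA LB eA eB
        (fun x => mul_div_cancel₀ _ (by norm_num)) (hi.div_const 12))
    rw [integral_div, div_eq_zero_iff] at hE
    have hE := hE.resolve_right (by norm_num)
    rw [← hE, ← integral_add (i1 _) (i2 _), ← integral_add (i1 _) (i2 _),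
      ← integral_add (i12 _) (i12 _)]
    rfl
  have hq : ∀ x, s * v x + z x = 0 := fun x =>
    Complex.ext (hre0 (by linarith) x) (him0 (by linarith) x)
  have hq' : ∀ x, s * v' x + z' x = 0 := fun x =>
    (dq x).unique ((hasDerivAt_const x (0 : ℂ)).congr_of_eventuallyEq (.of_forall hq))
  have hq'' : ∀ x, s * v'' x + z'' x = 0 := fun x =>
    (((hv' x).const_mul (s : ℂ)).fun_add (hz' x)).unique
      ((hasDerivAt_const x (0 : ℂ)).congr_of_eventuallyEq (.of_forall hq'))
  have hAB : ∀ x, A x + s * B x = 0 := fun x => by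
    rw [eA, eB]
    linear_combination (1 + 3 / 2 * sech2 x) * hq x - hq'' x / 4
      + 3 / 2 * sech2 x * z x * hs'
  have hvv : ∀ x, v x = β * v'' x := fun x => by
    have h := ((hA x).fun_add ((hB x).const_mul (s : ℂ))).unique
      ((hasDerivAt_const x (0 : ℂ)).congr_of_eventuallyEq (.of_forall hAB))
    refine sub_eq_zero.1 ((mul_eq_zero.1 ?_).resolve_left hlam0)
    linear_combination h + lam * s * (hq x - β * hq'' x) - lam * (v x - β * v'' x) * hs'
  have hv0 := eq_zero_of_eq_mul_second_deriv hβ hv hv' Lv Lv' hvv x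
  exact ⟨hv0, by simpa [hv0] using hq x⟩

lemma HasDerivAt.comp_mul_left_complex {f : ℝ → ℂ} {f' : ℂ} {L y : ℝ}
    (hf : HasDerivAt f f' (L * y)) : HasDerivAt (fun y => f (L * y)) (L * f') y := by
  refine (hf.scomp y ((hasDerivAt_id y).const_mul L)).congr_deriv ?_
  simp

/-- Regularity and integrability of the rescaling of a smooth function with square-integrable
derivatives. -/
lemma rescaled_profile {L : ℝ} (hL : L ≠ 0) {f : ℝ → ℂ} (hf : ContDiff ℝ (⊤ : ℕ∞) f)
    (hi : ∀ n : ℕ, Integrable fun x => ‖iteratedDeriv n f x‖ ^ 2) :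
    Differentiable ℝ f ∧ Differentiable ℝ (deriv (deriv f)) ∧
    (∀ y, HasDerivAt (fun y => f (L * y)) (L * deriv f (L * y)) y) ∧
    (∀ y, HasDerivAt (fun y => L * deriv f (L * y)) (L ^ 2 * deriv (deriv f) (L * y)) y) ∧
    MemLp (fun y => f (L * y)) 2 ∧ MemLp (fun y => L * deriv f (L * y)) 2 ∧
    MemLp (fun y => L ^ 2 * deriv (deriv f) (L * y)) 2 := by
  have hd : ∀ n, Differentiable ℝ (iteratedDeriv n f) := fun n =>
    hf.differentiable_iteratedDeriv n (by exact_mod_cast ENat.natCast_lt_top n)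
  have hm : ∀ n, MemLp (fun y => iteratedDeriv n f (L * y)) 2 := fun n => by
    have hc : Continuous fun y => iteratedDeriv n f (L * y) :=
      (hd n).continuous.comp (continuous_const_mul L)
    rw [memLp_two_iff_integrable_sq_norm hc.aestronglyMeasurable]
    exact (hi n).comp_mul_left' hL
  have e1 : iteratedDeriv 1 f = deriv f := iteratedDeriv_one
  have e2 : iteratedDeriv 2 f = deriv (deriv f) := by
    rw [iteratedDeriv_succ, e1]
  have hd0 := hd 0
  have hd1 := hd 1
  have hd2 := hd 2
  have hm0 := hm 0
  have hm1 := hm 1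
  have hm2 := hm 2
  rw [iteratedDeriv_zero] at hd0 hm0
  rw [e1] at hd1 hm1
  rw [e2] at hd2 hm2
  refine ⟨hd0, hd2, fun y => (hd0 _).hasDerivAt.comp_mul_left_complex, fun y => ?_,
    hm0, hm1.const_mul _, hm2.const_mul _⟩
  refine ((hd1 _).hasDerivAt.comp_mul_left_complex.const_mul (L : ℂ)).congr_deriv ?_
  ring

end Auxiliary

theorem stmt_18 (a b : ℝ) (ha : a < 0) (hb : 0 < b)
    (hratio : b / (-a) < (427 + 3 * Real.sqrt 41781) / 130)
    (c w : ℝ) (hc : c = a) (hw : w = 0)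
    (ε : ℝ) (hε : ε = -1 ∨ ε = 1)
    (φ ψ : ℝ → ℝ)
    (hφ : φ = fun x => -(3/2) * (1 / Real.cosh (x / (2 * Real.sqrt (-a))))^2)
    (hψ : ψ = fun x => ε * (3 / Real.sqrt 2)
        * (1 / Real.cosh (x / (2 * Real.sqrt (-a))))^2) :
    ¬ ∃ (lam : ℂ) (v z : ℝ → ℂ),
      0 < lam.re ∧
      (¬ ∀ x : ℝ, v x = 0 ∧ z x = 0) ∧
      ContDiff ℝ (⊤ : ℕ∞) v ∧ ContDiff ℝ (⊤ : ℕ∞) z ∧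
      (∀ n : ℕ, Integrable (fun x : ℝ => ‖iteratedDeriv n v x‖^2)) ∧
      (∀ n : ℕ, Integrable (fun x : ℝ => ‖iteratedDeriv n z x‖^2)) ∧
      (∀ x : ℝ,
        -deriv (fun y : ℝ => (ψ y : ℂ) * v y + z y
            + (a : ℂ) * deriv (deriv z) y + (φ y : ℂ) * z y) x
          = lam * (v x - (b : ℂ) * deriv (deriv v) x)) ∧
      (∀ x : ℝ,
        -deriv (fun y : ℝ => v y + (a : ℂ) * deriv (deriv v) y
            + (ψ y : ℂ) * z y) x
          = lam * (z x - (b : ℂ) * deriv (deriv z) x)) := by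
  rintro ⟨lam, v, z, hlam, hnt, hv, hz, iv, iz, h1, h2⟩
  subst hc hφ hψ
  set L : ℝ := 2 * Real.sqrt (-c) with hL
  have hL0 : 0 < L := by
    have := Real.sqrt_pos.2 (neg_pos.2 ha)
    positivity
  have hL2 : L ^ 2 = -4 * c := by
    rw [hL, mul_pow, Real.sq_sqrt (neg_pos.2 ha).le]; ring
  have hLc : (L : ℂ) ≠ 0 := by exact_mod_cast hL0.ne'
  have hL2' : (L : ℂ) ^ 2 = -4 * c := by exact_mod_cast hL2
  have hr2 : 0 < Real.sqrt 2 := by positivity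
  have hr2' : Real.sqrt 2 ^ 2 = 2 := Real.sq_sqrt (by norm_num)
  have hβ' : b / L ^ 2 < 2001 / 1000 := by
    have hsq : Real.sqrt 41781 ≤ 204405 / 1000 := Real.sqrt_le_iff.2 (by norm_num)
    have e : b / L ^ 2 = b / (-c) / 4 := by
      rw [hL2]; field_simp
    rw [e]; linarith
  have hs : (ε * Real.sqrt 2) ^ 2 = 2 := by
    rw [mul_pow, hr2']; rcases hε with rfl | rfl <;> norm_num
  have hψL : ∀ y, ε * (3 / Real.sqrt 2) * (1 / Real.cosh (L * y / L)) ^ 2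
      = 3 / 2 * (ε * Real.sqrt 2) * sech2 y := fun y => by
    rw [mul_div_cancel_left₀ _ hL0.ne', sech2, div_pow, one_pow]
    field_simp
    linear_combination -ε * hr2'
  have hφL : ∀ y, -(3 / 2) * (1 / Real.cosh (L * y / L)) ^ 2 = -(3 / 2) * sech2 y := fun y => by
    rw [mul_div_cancel_left₀ _ hL0.ne', sech2, div_pow, one_pow]
  have hcosh : Differentiable ℝ fun y => (1 / Real.cosh (y / L)) ^ 2 := by
    have : ∀ y, Real.cosh (y / L) ≠ 0 := fun y => (Real.cosh_pos _).ne'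
    fun_prop (disch := exact this _)
  have hψd : Differentiable ℝ fun y =>
      ((ε * (3 / Real.sqrt 2) * (1 / Real.cosh (y / L)) ^ 2 : ℝ) : ℂ) := fun y =>
    ((hcosh y).const_mul _).hasDerivAt.ofReal_comp.differentiableAt
  have hφd : Differentiable ℝ fun y =>
      ((-(3 / 2) * (1 / Real.cosh (y / L)) ^ 2 : ℝ) : ℂ) := fun y =>
    ((hcosh y).const_mul _).hasDerivAt.ofReal_comp.differentiableAt
  obtain ⟨cv, cv2, dv, dv', Lv, Lv', Lv''⟩ := rescaled_profile hL0.ne' hv iv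
  obtain ⟨cz, cz2, dz, dz', Lz, Lz', Lz''⟩ := rescaled_profile hL0.ne' hz iz
  refine hnt fun x => ?_
  have key := eigenfunction_eq_zero (div_pos hb (pow_pos hL0 2)) hβ' hs
    (lam := L * lam) (by simpa using mul_pos hL0 hlam) dv dv' dz dz'
    (A := fun y => ((ε * (3 / Real.sqrt 2) * (1 / Real.cosh (L * y / L)) ^ 2 : ℝ) : ℂ) * v (L * y)
      + z (L * y) + (c : ℂ) * deriv (deriv z) (L * y)
      + ((-(3 / 2) * (1 / Real.cosh (L * y / L)) ^ 2 : ℝ) : ℂ) * z (L * y))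
    (B := fun y => v (L * y) + (c : ℂ) * deriv (deriv v) (L * y)
      + ((ε * (3 / Real.sqrt 2) * (1 / Real.cosh (L * y / L)) ^ 2 : ℝ) : ℂ) * z (L * y))
    (fun y => ?_) (fun y => ?_) Lv Lv' Lv'' Lz Lz' Lz'' (fun y => ?_) (fun y => ?_) (x / L)
  · rwa [mul_div_cancel₀ _ hL0.ne'] at key
  · have hd : DifferentiableAt ℝ (fun y =>
        ((ε * (3 / Real.sqrt 2) * (1 / Real.cosh (y / L)) ^ 2 : ℝ) : ℂ) * v y + z y
          + (c : ℂ) * deriv (deriv z) y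
          + ((-(3 / 2) * (1 / Real.cosh (y / L)) ^ 2 : ℝ) : ℂ) * z y) (L * y) :=
      ((((hψd _).mul (cv _)).add (cz _)).add ((cz2 _).const_mul _)).add ((hφd _).mul (cz _))
    have h := hd.hasDerivAt
    rw [neg_eq_iff_eq_neg.1 (h1 (L * y))] at h
    refine h.comp_mul_left_complex.congr_deriv ?_
    push_cast
    field_simp
  · have hd : DifferentiableAt ℝ (fun y => v y + (c : ℂ) * deriv (deriv v) y
          + ((ε * (3 / Real.sqrt 2) * (1 / Real.cosh (y / L)) ^ 2 : ℝ) : ℂ) * z y) (L * y) :=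
      ((cv _).add ((cv2 _).const_mul _)).add ((hψd _).mul (cz _))
    have h := hd.hasDerivAt
    rw [neg_eq_iff_eq_neg.1 (h2 (L * y))] at h
    refine h.comp_mul_left_complex.congr_deriv ?_
    push_cast
    field_simp
  · rw [hψL, hφL]
    push_cast
    linear_combination deriv (deriv z) (L * y) / 4 * hL2'
  · rw [hψL]
    push_cast
    linear_combination deriv (deriv v) (L * y) / 4 * hL2'
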